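/- arXiv:2209.07685 — 2 statements merged into one kernel-verified Lean document; each statement's English description precedes it below -/
import Mathlib

section
/- Let n, m, N ∈ ℕ, let 𝒳 ⊆ ℝ^n and 𝒰 ⊆ ℝ^m, and let K_F, K_Φ, K_ψ, δ, τ, μ ≥ 0 and M, β, λ > 0 be real constants. Suppose: (i) F : ℝ^n × ℝ^m → ℝ^n is Lipschitz with constant K_F and F(0, 0) = 0; (ii) Φ : ℝ^n → ℝ^N is differentiable with ‖DΦ(w)‖ ≤ K_Φ (operator norm) for all w; (iii) ψ : ℝ^n × ℝ^m → ℝ^N is Lipschitz with constant K_ψ; (iv) h : ℝ^N → ℝ is differentiable with ‖Dh(z)‖ < M for all z; (v) there is a dataset 𝒟 ⊆ 𝒳 × 𝒰 such that every (x, u) ∈ 𝒳 × 𝒰 admits a point (y, v) ∈ 𝒟 with ‖(x, u) − (y, v)‖ ≤ δ, and such that every (y, v) ∈ 𝒟 satisfies ‖DΦ(y)(F(y, v)) − ψ(y, v)‖ ≤ μ and ‖(y, v)‖ ≤ τ; (vi) K_Φ K_F δ + 2 K_Φ K_F τ + μ + K_ψ δ < β/M. Then for every (x, u) ∈ 𝒳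 × 𝒰 satisfying the margin inequality Dh(Φ(x))(ψ(x, u)) ≥ β − λ·h(Φ(x)), one has Dh(Φ(x))(DΦ(x)(F(x, u))) > −λ·h(Φ(x)). In other words, a CBF with margin β for the learned model ψ is also a valid CBF for the unknown system ẋ = F(x, u) in the lifted coordinates z = Φ(x). (Theorem 2 of the paper.) -/
open scoped BigOperators

/-- The concatenated vector `(x, u) ∈ ℝ^n × ℝ^m`, carrying the Euclidean (ℓ²) norm
`‖(x, u)‖ = sqrt (‖x‖² + ‖u‖²)` of the stacked vector `[xᵀ, uᵀ]ᵀ`. -/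
noncomputable def concat (n m : ℕ) (x : EuclideanSpace ℝ (Fin n))
    (u : EuclideanSpace ℝ (Fin m)) :
    WithLp 2 (EuclideanSpace ℝ (Fin n) × EuclideanSpace ℝ (Fin m)) :=
  (WithLp.equiv 2 (EuclideanSpace ℝ (Fin n) × EuclideanSpace ℝ (Fin m))).symm (x, u)

/-- Evaluating two operators of norm at most `K` at two vectors: the first value is close to any
approximation of the second one. -/
theorem norm_apply_sub_le_of_approx {E G : Type*} [NormedAddCommGroup E] [NormedSpace ℝ E]
    [NormedAddCommGroup G] [NormedSpace ℝ G] {A B : E →L[ℝ] G} {K a b c d : ℝ} {v w : E} {p q : G}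
    (hA : ‖A‖ ≤ K) (hB : ‖B‖ ≤ K) (hvw : ‖v - w‖ ≤ a) (hw : ‖w‖ ≤ b)
    (hq : ‖B w - q‖ ≤ c) (hpq : ‖p - q‖ ≤ d) :
    ‖A v - p‖ ≤ K * a + 2 * K * b + c + d := by
  have hAB : ‖A - B‖ ≤ 2 * K := (norm_sub_le A B).trans (by linarith)
  have hsplit : A v - p = A (v - w) + (A - B) w + (B w - q) + (q - p) := by
    simp only [map_sub, sub_apply]
    abel
  rw [hsplit]
  rw [norm_sub_rev] at hpq
  exact norm_add_le_of_le (norm_add_le_of_le (norm_add_le_of_le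
    (A.le_of_opNorm_le_of_le hA hvw) ((A - B).le_of_opNorm_le_of_le hAB hw)) hq) hpq

/-- **Theorem 2 of the paper.** Under the Lipschitz, derivative-bound, dataset density,
training residual and smallness hypotheses (i)–(vi), every pair `(x, u) ∈ 𝒳 × 𝒰` satisfying
the margin inequality `Dh(Φ(x))(ψ(x, u)) ≥ β − λ·h(Φ(x))` for the learned lifted model `ψ`
also satisfies `Dh(Φ(x))(DΦ(x)(F(x, u))) > −λ·h(Φ(x))`: a CBF with margin `β` for the
learned model is a valid CBF for the unknown system `ẋ = F(x, u)` in lifted coordinates. -/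
theorem learned_cbf_valid_for_unknown_system
    (n m N : ℕ)
    (𝒳 : Set (EuclideanSpace ℝ (Fin n))) (𝒰 : Set (EuclideanSpace ℝ (Fin m)))
    (K_F K_Φ K_ψ δ τ μ : ℝ)
    (hKF : 0 ≤ K_F) (hKΦ : 0 ≤ K_Φ) (hKψ : 0 ≤ K_ψ)
    (hδ0 : 0 ≤ δ) (hτ0 : 0 ≤ τ) (hμ0 : 0 ≤ μ)
    (M β lam : ℝ) (hM : 0 < M) (hβ : 0 < β) (hlam : 0 < lam)
    -- (i) `F` is `K_F`-Lipschitz and vanishes at the origin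
    (F : EuclideanSpace ℝ (Fin n) → EuclideanSpace ℝ (Fin m) → EuclideanSpace ℝ (Fin n))
    (hFLip : ∀ x u y v, ‖F x u - F y v‖ ≤ K_F * ‖concat n m x u - concat n m y v‖)
    (hF0 : F 0 0 = 0)
    -- (ii) `Φ` is differentiable with `‖DΦ(w)‖ ≤ K_Φ`
    (Φ : EuclideanSpace ℝ (Fin n) → EuclideanSpace ℝ (Fin N))
    (hΦdiff : Differentiable ℝ Φ)
    (hDΦ : ∀ w, ‖fderiv ℝ Φ w‖ ≤ K_Φ)
    -- (iii) `ψ` is `K_ψ`-Lipschitz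
    (ψ : EuclideanSpace ℝ (Fin n) → EuclideanSpace ℝ (Fin m) → EuclideanSpace ℝ (Fin N))
    (hψLip : ∀ x u y v, ‖ψ x u - ψ y v‖ ≤ K_ψ * ‖concat n m x u - concat n m y v‖)
    -- (iv) `h` is differentiable with `‖Dh(z)‖ < M`
    (h : EuclideanSpace ℝ (Fin N) → ℝ)
    (hhdiff : Differentiable ℝ h)
    (hDh : ∀ z, ‖fderiv ℝ h z‖ < M)
    -- (v) the dataset `𝒟 ⊆ 𝒳 × 𝒰` is `δ`-dense in `𝒳 × 𝒰`, with residual bound `μ`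
    --     and norm bound `τ` on every training sample
    (𝒟 : Set (EuclideanSpace ℝ (Fin n) × EuclideanSpace ℝ (Fin m)))
    (h𝒟 : 𝒟 ⊆ 𝒳 ×ˢ 𝒰)
    (hdense : ∀ x ∈ 𝒳, ∀ u ∈ 𝒰, ∃ p ∈ 𝒟, ‖concat n m x u - concat n m p.1 p.2‖ ≤ δ)
    (hres : ∀ p ∈ 𝒟, ‖fderiv ℝ Φ p.1 (F p.1 p.2) - ψ p.1 p.2‖ ≤ μ)
    (hτ : ∀ p ∈ 𝒟, ‖concat n m p.1 p.2‖ ≤ τ)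
    -- (vi) smallness of the total error bound
    (hsmall : K_Φ * K_F * δ + 2 * K_Φ * K_F * τ + μ + K_ψ * δ < β / M) :
    ∀ x ∈ 𝒳, ∀ u ∈ 𝒰,
      fderiv ℝ h (Φ x) (ψ x u) ≥ β - lam * h (Φ x) →
      fderiv ℝ h (Φ x) (fderiv ℝ Φ x (F x u)) > -(lam * h (Φ x)) := by
  intro x hx u hu hmargin
  obtain ⟨p, hp, hdist⟩ := hdense x hx u hu
  have hFp : ‖F p.1 p.2‖ ≤ K_F * τ := by
    have hzero : concat n m 0 0 = 0 := rfl
    have hlip := hFLip p.1 p.2 0 0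
    rw [hF0, hzero, sub_zero, sub_zero] at hlip
    exact hlip.trans (mul_le_mul_of_nonneg_left (hτ p hp) hKF)
  have herr := norm_apply_sub_le_of_approx (hDΦ x) (hDΦ p.1)
    ((hFLip x u p.1 p.2).trans (mul_le_mul_of_nonneg_left hdist hKF)) hFp (hres p hp)
    ((hψLip x u p.1 p.2).trans (mul_le_mul_of_nonneg_left hdist hKψ))
  have hlt : ‖fderiv ℝ Φ x (F x u) - ψ x u‖ < β / M := herr.trans_lt (by linarith)
  have hDh_err := (fderiv ℝ h (Φ x)).le_of_opNorm_le (hDh (Φ x)).le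
    (fderiv ℝ Φ x (F x u) - ψ x u)
  rw [map_sub, Real.norm_eq_abs] at hDh_err
  rw [lt_div_iff₀' hM] at hlt
  linarith [neg_le_of_abs_le hDh_err]
end

section
/- Let n, m, N ∈ ℕ, let 𝒳 ⊆ ℝ^n and 𝒰 ⊆ ℝ^m, and let K_F, K_Φ, K_ψ, δ, τ, μ ≥ 0 and M, β, λ > 0. Assume hypotheses (i)–(vi): F : ℝ^n × ℝ^m → ℝ^n Lipschitz with constant K_F with F(0,0) = 0; Φ : ℝ^n → ℝ^N differentiable with ‖DΦ(w)‖ ≤ K_Φ for all w; ψ : ℝ^n × ℝ^m → ℝ^N Lipschitz with constant K_ψ; h : ℝ^N → ℝ differentiable with ‖Dh(z)‖ < M for all z; a dataset 𝒟 ⊆ 𝒳 × 𝒰 such that every (x, u) ∈ 𝒳 × 𝒰 is within distance δ of some (y, v) ∈ 𝒟, with ‖DΦ(y)(F(y, v)) − ψ(y, v)‖ ≤ μ and ‖(y, v)‖ ≤ τ for all (y, v) ∈ 𝒟; and K_Φ K_F δ + 2 K_Φ K_F τ + μ + K_ψ δ < β/M. Suppose moreover that there is a finite set U ⊆ 𝒰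 such that for every x ∈ 𝒳 there exists u_s ∈ U with Dh(Φ(x))(ψ(x, u_s)) ≥ β − λ·h(Φ(x)) (i.e., the falsifier finds no counterexample). Then for every x ∈ 𝒳 there exists u ∈ 𝒰 such that Dh(Φ(x))(DΦ(x)(F(x, u))) ≥ −λ·h(Φ(x)); that is, h is a valid CBF for the unknown nonlinear system ẋ = F(x, u) in the lifted coordinates z = Φ(x). (Combination of Theorems 1 and 2 of the paper.) -/
open scoped BigOperators

/-- The concatenation of two zero vectors is the zero vector. -/
lemma concat_zero_zero (n m : ℕ) : concat n m 0 0 = 0 := rfl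

/-- Perturbation bound for operators applied to vectors: replacing both the operator `B` by `A`
and the vector `b` by `a`, with operators of norm at most `K`. -/
lemma norm_apply_sub_apply_le {E G : Type*} [NormedAddCommGroup E] [NormedSpace ℝ E]
    [NormedAddCommGroup G] [NormedSpace ℝ G] {A B : E →L[ℝ] G} {K : ℝ}
    (hA : ‖A‖ ≤ K) (hB : ‖B‖ ≤ K) (a b : E) :
    ‖A a - B b‖ ≤ K * ‖a - b‖ + 2 * K * ‖b‖ := by
  have hsplit : A a - B b = A (a - b) + (A - B) b := by
    simp
  have hAB : ‖A - B‖ ≤ 2 * K := (norm_sub_le A B).trans (by linarith)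
  rw [hsplit]
  exact norm_add_le_of_le (A.le_of_opNorm_le hA _) ((A - B).le_of_opNorm_le hAB _)

/-- **Combination of Theorems 1 and 2 of the paper.** Under hypotheses (i)–(vi), if in
addition there is a finite candidate input set `U ⊆ 𝒰` such that for every `x ∈ 𝒳` the
falsifier finds no counterexample, i.e. some `uₛ ∈ U` satisfies the margin inequality
`Dh(Φ(x))(ψ(x, uₛ)) ≥ β − λ·h(Φ(x))` for the learned lifted model `ψ`, then `h` is a
valid CBF for the unknown system `ẋ = F(x, u)` in lifted coordinates: for every `x ∈ 𝒳`
there exists `u ∈ 𝒰` with `Dh(Φ(x))(DΦ(x)(F(x, u))) ≥ −λ·h(Φ(x))`. -/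
theorem learned_cbf_valid_for_unknown_system_combined
    (n m N : ℕ)
    (𝒳 : Set (EuclideanSpace ℝ (Fin n))) (𝒰 : Set (EuclideanSpace ℝ (Fin m)))
    (K_F K_Φ K_ψ δ τ μ : ℝ)
    (hKF : 0 ≤ K_F) (hKΦ : 0 ≤ K_Φ) (hKψ : 0 ≤ K_ψ)
    (hδ0 : 0 ≤ δ) (hτ0 : 0 ≤ τ) (hμ0 : 0 ≤ μ)
    (M β lam : ℝ) (hM : 0 < M) (hβ : 0 < β) (hlam : 0 < lam)
    -- (i) `F` is `K_F`-Lipschitz and vanishes at the origin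
    (F : EuclideanSpace ℝ (Fin n) → EuclideanSpace ℝ (Fin m) → EuclideanSpace ℝ (Fin n))
    (hFLip : ∀ x u y v, ‖F x u - F y v‖ ≤ K_F * ‖concat n m x u - concat n m y v‖)
    (hF0 : F 0 0 = 0)
    -- (ii) `Φ` is differentiable with `‖DΦ(w)‖ ≤ K_Φ`
    (Φ : EuclideanSpace ℝ (Fin n) → EuclideanSpace ℝ (Fin N))
    (hΦdiff : Differentiable ℝ Φ)
    (hDΦ : ∀ w, ‖fderiv ℝ Φ w‖ ≤ K_Φ)
    -- (iii) `ψ` is `K_ψ`-Lipschitz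
    (ψ : EuclideanSpace ℝ (Fin n) → EuclideanSpace ℝ (Fin m) → EuclideanSpace ℝ (Fin N))
    (hψLip : ∀ x u y v, ‖ψ x u - ψ y v‖ ≤ K_ψ * ‖concat n m x u - concat n m y v‖)
    -- (iv) `h` is differentiable with `‖Dh(z)‖ < M`
    (h : EuclideanSpace ℝ (Fin N) → ℝ)
    (hhdiff : Differentiable ℝ h)
    (hDh : ∀ z, ‖fderiv ℝ h z‖ < M)
    -- (v) the dataset `𝒟 ⊆ 𝒳 × 𝒰` is `δ`-dense in `𝒳 × 𝒰`, with residual bound `μ`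
    --     and norm bound `τ` on every training sample
    (𝒟 : Set (EuclideanSpace ℝ (Fin n) × EuclideanSpace ℝ (Fin m)))
    (h𝒟 : 𝒟 ⊆ 𝒳 ×ˢ 𝒰)
    (hdense : ∀ x ∈ 𝒳, ∀ u ∈ 𝒰, ∃ p ∈ 𝒟, ‖concat n m x u - concat n m p.1 p.2‖ ≤ δ)
    (hres : ∀ p ∈ 𝒟, ‖fderiv ℝ Φ p.1 (F p.1 p.2) - ψ p.1 p.2‖ ≤ μ)
    (hτ : ∀ p ∈ 𝒟, ‖concat n m p.1 p.2‖ ≤ τ)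
    -- (vi) smallness of the total error bound
    (hsmall : K_Φ * K_F * δ + 2 * K_Φ * K_F * τ + μ + K_ψ * δ < β / M)
    -- the falsifier finds no counterexample on the finite candidate input set `U ⊆ 𝒰`
    (U : Finset (EuclideanSpace ℝ (Fin m)))
    (hU𝒰 : (U : Set (EuclideanSpace ℝ (Fin m))) ⊆ 𝒰)
    (hfals : ∀ x ∈ 𝒳, ∃ us ∈ U, fderiv ℝ h (Φ x) (ψ x us) ≥ β - lam * h (Φ x)) :
    ∀ x ∈ 𝒳, ∃ u ∈ 𝒰,
      fderiv ℝ h (Φ x) (fderiv ℝ Φ x (F x u)) ≥ -(lam * h (Φ x)) := by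
  intro x hx
  obtain ⟨u, huU, hu⟩ := hfals x hx
  have hu𝒰 : u ∈ 𝒰 := hU𝒰 huU
  refine ⟨u, hu𝒰, ?_⟩
  obtain ⟨⟨y, v⟩, hp, hd⟩ := hdense x hx u hu𝒰
  have hr := hres _ hp
  have ht := hτ _ hp
  dsimp only at hd hr ht
  have hF : ‖F x u - F y v‖ ≤ K_F * δ :=
    (hFLip x u y v).trans (mul_le_mul_of_nonneg_left hd hKF)
  have hFy : ‖F y v‖ ≤ K_F * τ := by
    have h0 := hFLip y v 0 0
    rw [hF0, concat_zero_zero, sub_zero, sub_zero] at h0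
    exact h0.trans (mul_le_mul_of_nonneg_left ht hKF)
  have hψ : ‖ψ y v - ψ x u‖ ≤ K_ψ * δ := by
    rw [norm_sub_rev]
    exact (hψLip x u y v).trans (mul_le_mul_of_nonneg_left hd hKψ)
  have hΦ := norm_apply_sub_apply_le (hDΦ x) (hDΦ y) (F x u) (F y v)
  set e := fderiv ℝ Φ x (F x u) - ψ x u with he
  have he_lt : ‖e‖ < β / M := by
    have hsplit : e = (fderiv ℝ Φ x (F x u) - fderiv ℝ Φ y (F y v))
        + (fderiv ℝ Φ y (F y v) - ψ y v) + (ψ y v - ψ x u) := by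
      rw [he]; abel
    have h1 := mul_le_mul_of_nonneg_left hF hKΦ
    have h2 := mul_le_mul_of_nonneg_left hFy (mul_nonneg zero_le_two hKΦ)
    rw [hsplit]
    refine norm_add₃_le.trans_lt ?_
    linarith
  have hhe : ‖fderiv ℝ h (Φ x) e‖ ≤ β := by
    refine ((fderiv ℝ h (Φ x)).le_of_opNorm_le (hDh _).le e).trans ?_
    rw [lt_div_iff₀ hM] at he_lt
    linarith
  have hge := (abs_le.mp hhe).1
  rw [he, map_sub] at hge
  linarith
end
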